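/- Let up be a non-trivial unordered partition of [1,k] with paritycount(up) = (e,o), and let m = |V|. Then |usage⁻¹(up)| = |Wit(V,t,o)| · (m−o)!/(m−o−e)!. -/

import Mathlib

/-- The usage pattern of a tuple `v = (v_1,…,v_k)`: the unordered partition of `[1,k]`
induced by the equivalence `i ≡_v j ↔ v_i = v_j`. -/
def usage {d k : ℕ} (v : Fin k → (Fin d → ZMod 2)) : Finset (Finset (Fin k)) :=
  Finset.image (fun i => Finset.univ.filter (fun j => v j = v i)) Finset.univ

theorem exists_class_map {α : Type*} [Fintype α] [DecidableEq α] {P : Finset (Finset α)}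
    (hdisj : ∀ S ∈ P, ∀ T ∈ P, S ≠ T → Disjoint S T) (hcover : P.biUnion id = Finset.univ) :
    ∃ c : α → {S // S ∈ P}, ∀ i S, i ∈ S.1 ↔ c i = S := by
  have h : ∀ i : α, ∃ S : {S // S ∈ P}, i ∈ S.1 := by
    intro i
    have hi : i ∈ P.biUnion id := by simp [hcover]
    obtain ⟨S, hS, hiS⟩ := Finset.mem_biUnion.1 hi
    exact ⟨⟨S, hS⟩, hiS⟩
  choose c hc using h
  refine ⟨c, fun i S => ⟨fun hi => ?_, fun h => h ▸ hc i⟩⟩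
  by_contra hne
  exact Finset.disjoint_left.1
    (hdisj _ (c i).2 _ S.2 (fun h => hne (Subtype.ext h))) (hc i) hi

theorem usage_eq_iff {d k : ℕ} {P : Finset (Finset (Fin k))} (hne : ∀ S ∈ P, S ≠ ∅)
    {c : Fin k → {S // S ∈ P}} (hc : ∀ i S, i ∈ S.1 ↔ c i = S)
    (v : Fin k → (Fin d → ZMod 2)) :
    usage v = P ↔ ∀ i j, v i = v j ↔ c i = c j := by
  constructor
  · intro h i j
    have hmem : Finset.univ.filter (fun l => v l = v j) ∈ P := by
      rw [← h]
      exact Finset.mem_image_of_mem _ (Finset.mem_univ j)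
    have hj := (hc j ⟨_, hmem⟩).1 (by simp)
    rw [hj, ← hc i ⟨_, hmem⟩]
    simp
  · intro h
    have hclass : ∀ i, Finset.univ.filter (fun j => v j = v i) = (c i).1 := by
      intro i
      ext j
      simp [h, hc]
    ext S
    simp only [usage, Finset.mem_image, Finset.mem_univ, true_and, hclass]
    constructor
    · rintro ⟨i, rfl⟩
      exact (c i).2
    · intro hS
      obtain ⟨i, hi⟩ := Finset.nonempty_iff_ne_empty.2 (hne S hS)
      exact ⟨i, congrArg Subtype.val ((hc i ⟨S, hS⟩).1 hi)⟩

theorem sum_comp_eq_sum_inl {ι α β M : Type*} [Fintype ι] [Fintype α] [Fintype β]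
    [DecidableEq α] [DecidableEq β] [AddCommGroup M] [Module (ZMod 2) M]
    (q : ι → α ⊕ β)
    (hodd : ∀ a, Odd (Finset.univ.filter (fun i => q i = Sum.inl a)).card)
    (heven : ∀ b, Even (Finset.univ.filter (fun i => q i = Sum.inr b)).card)
    (f : α ⊕ β → M) :
    ∑ i, f (q i) = ∑ a, f (Sum.inl a) := by
  have hfib : ∀ x, ∑ i ∈ Finset.univ.filter (fun i => q i = x), f (q i)
      = ((Finset.univ.filter (fun i => q i = x)).card : ZMod 2) • f x := by
    intro x
    rw [Finset.sum_congr rfl (g := fun _ => f x) (fun i hi => by simp_all),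
      Finset.sum_const, Nat.cast_smul_eq_nsmul]
  rw [← Finset.sum_fiberwise Finset.univ q, Fintype.sum_sum_type]
  simp [hfib, (ZMod.natCast_eq_one_iff_odd).2 (hodd _),
    (ZMod.natCast_eq_zero_iff_even).2 (heven _)]

/-- Embeddings of `α` into a finset `V`, as injective functions with values in `V`. -/
def embeddingFinsetEquiv {α M : Type*} (V : Finset M) (p : (α → M) → Prop) :
    {f : α ↪ V // p (fun a => f a)} ≃
      {w : α → M // (∀ i, w i ∈ V) ∧ p w ∧ ∀ i j, i ≠ j → w i ≠ w j} where
  toFun f := ⟨fun a => f.1 a, fun i => (f.1 i).2, f.2,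
    fun _ _ hij h => hij (f.1.injective (Subtype.ext h))⟩
  invFun w := ⟨⟨fun a => ⟨w.1 a, w.2.1 a⟩, fun i j h => by
    by_contra hij
    exact w.2.2.2 i j hij (congrArg Subtype.val h)⟩, w.2.2.1⟩
  left_inv _ := rfl
  right_inv _ := rfl

theorem card_embedding_sum {α β γ : Type*} [Fintype α] [Fintype β] [Fintype γ]
    (p : (α ↪ γ) → Prop) :
    Nat.card {f : α ⊕ β ↪ γ // p (Function.Embedding.inl.trans f)}
      = Nat.card {f : α ↪ γ // p f}
        * (Fintype.card γ - Fintype.card α).descFactorial (Fintype.card β) := by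
  classical
  have e₁ : {f : α ⊕ β ↪ γ // p (Function.Embedding.inl.trans f)} ≃
      {x : Σ f : α ↪ γ, β ↪ ↥(Set.range f)ᶜ // p x.1} :=
    Equiv.sumEmbeddingEquivSigmaEmbeddingRestricted.subtypeEquiv fun _ => Iff.rfl
  rw [Nat.card_congr (e₁.trans (Equiv.subtypeSigmaEquiv _ p)), Nat.card_sigma]
  have hcard : ∀ f : {f : α ↪ γ // p f}, Nat.card (β ↪ ↥(Set.range f.1)ᶜ)
      = (Fintype.card γ - Fintype.card α).descFactorial (Fintype.card β) := by
    intro f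
    rw [Nat.card_eq_fintype_card, Fintype.card_embedding_eq, Fintype.card_compl_set,
      Set.card_range_of_injective f.1.injective]
  rw [Finset.sum_congr rfl fun f _ => hcard f, Finset.sum_const, Finset.card_univ,
    smul_eq_mul, Nat.card_eq_fintype_card]

theorem card_fiber_eq_card_embedding {ι κ M : Type*} (V : Finset M) {q : ι → κ}
    (hq : Function.Surjective q) (p : (ι → M) → Prop) :
    Nat.card {v : ι → M // (∀ i, v i ∈ V) ∧ p v ∧ ∀ i j, v i = v j ↔ q i = q j}
      = Nat.card {f : κ ↪ V // p (fun i => f (q i))} := by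
  symm
  refine Nat.card_congr (Equiv.ofBijective (fun f => ⟨fun i => f.1 (q i),
    fun i => (f.1 (q i)).2, f.2, fun i j => ?_⟩) ⟨?_, ?_⟩)
  · rw [← Subtype.ext_iff, f.1.injective.eq_iff]
  · intro f g h
    ext x
    obtain ⟨i, rfl⟩ := hq x
    exact congrFun (congrArg Subtype.val h) i
  · rintro ⟨v, hV, hp, hv⟩
    obtain ⟨s, hs⟩ := hq.hasRightInverse
    have hvs : ∀ i, v (s (q i)) = v i := fun i => (hv _ _).2 (hs _)
    refine ⟨⟨⟨fun x => ⟨v (s x), hV _⟩, fun x y h => ?_⟩, ?_⟩, ?_⟩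
    · rw [← hs x, ← hs y]
      exact (hv _ _).1 (congrArg Subtype.val h)
    · exact (congrArg p (funext hvs)).mpr hp
    · exact Subtype.ext (funext hvs)

/-- The classes of a finite family, odd ones first, numbered separately by parity. -/
theorem exists_parity_equiv {α : Type*} (P : Finset (Finset α)) :
    ∃ g : {S // S ∈ P} ≃
        Fin (P.filter (fun S => Odd S.card)).card ⊕ Fin (P.filter (fun S => Even S.card)).card,
      (∀ a, Odd (g.symm (Sum.inl a)).1.card) ∧ ∀ b, Even (g.symm (Sum.inr b)).1.card := by
  let eO := (Equiv.subtypeSubtypeEquivSubtypeInter (· ∈ P) (fun S => Odd S.card)).trans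
    ((Equiv.subtypeEquivRight fun S => (Finset.mem_filter (s := P)).symm).trans
      (P.filter (fun S => Odd S.card)).equivFin)
  let eE := (Equiv.subtypeSubtypeEquivSubtypeInter (· ∈ P) (fun S => ¬ Odd S.card)).trans
    ((Equiv.subtypeEquivRight fun S => by
      rw [Finset.mem_filter, Nat.not_odd_iff_even]).trans
      (P.filter (fun S => Even S.card)).equivFin)
  exact ⟨(Equiv.sumCompl (fun S : {S // S ∈ P} => Odd S.1.card)).symm.trans
    (Equiv.sumCongr eO eE), fun a => (eO.symm a).2,
    fun b => Nat.not_odd_iff_even.1 (eE.symm b).2⟩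

/-- Let `up` be a non-trivial unordered partition of `[1,k]` with
`paritycount(up) = (e,o)` (`e` classes of even and `o` classes of odd cardinality), and
let `m = |V|`, with `m − o − e ≥ 0`. Then
`|usage⁻¹(up)| = |Wit(V,t,o)| · (m−o)!/(m−o−e)!`. -/
theorem card_usage_fiber (d k : ℕ) (V : Finset (Fin d → ZMod 2)) (t : Fin d → ZMod 2)
    (P : Finset (Finset (Fin k))) (e o : ℕ)
    (hpart : (∀ S ∈ P, S ≠ ∅) ∧ (∀ S ∈ P, ∀ T ∈ P, S ≠ T → Disjoint S T) ∧
      P.biUnion id = Finset.univ)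
    (hnontriv : ¬(∀ S ∈ P, S.card = 1))
    (he : e = (P.filter (fun S => Even S.card)).card)
    (ho : o = (P.filter (fun S => Odd S.card)).card)
    (hm : o + e ≤ V.card) :
    Nat.card {v : Fin k → (Fin d → ZMod 2) //
        (∀ i, v i ∈ V) ∧ ∑ i, v i = t ∧ (∃ i j, i ≠ j ∧ v i = v j) ∧ usage v = P}
      = Nat.card {w : Fin o → (Fin d → ZMod 2) //
          (∀ i, w i ∈ V) ∧ ∑ i, w i = t ∧ ∀ i j, i ≠ j → w i ≠ w j}
        * ((V.card - o).factorial / (V.card - o - e).factorial) := by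
  classical
  obtain ⟨hne, hdisj, hcover⟩ := hpart
  obtain ⟨c, hc⟩ := exists_class_map hdisj hcover
  obtain ⟨g, hgo, hge⟩ := exists_parity_equiv P
  subst he ho
  let q := fun i => g (c i)
  have hq : Function.Surjective q := by
    refine g.surjective.comp fun S => ?_
    obtain ⟨i, hi⟩ := Finset.nonempty_iff_ne_empty.2 (hne S.1 S.2)
    exact ⟨i, (hc i S).1 hi⟩
  have hclass : ∀ x, Finset.univ.filter (fun i => q i = x) = (g.symm x).1 := by
    intro x
    ext i
    simp [q, hc, Equiv.eq_symm_apply]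
  have hrep : ∃ i j, i ≠ j ∧ c i = c j := by
    push Not at hnontriv
    obtain ⟨S, hS, hcard⟩ := hnontriv
    have hpos := Finset.card_pos.2 (Finset.nonempty_iff_ne_empty.2 (hne S hS))
    obtain ⟨i, hi, j, hj, hij⟩ := Finset.one_lt_card.1 (show 1 < S.card by omega)
    exact ⟨i, j, hij, ((hc i ⟨S, hS⟩).1 hi).trans ((hc j ⟨S, hS⟩).1 hj).symm⟩
  have hfiber : ∀ v : Fin k → (Fin d → ZMod 2),
      ((∀ i, v i ∈ V) ∧ ∑ i, v i = t ∧ (∃ i j, i ≠ j ∧ v i = v j) ∧ usage v = P) ↔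
        ((∀ i, v i ∈ V) ∧ ∑ i, v i = t ∧ ∀ i j, v i = v j ↔ q i = q j) := by
    intro v
    rw [usage_eq_iff hne hc]
    simp only [q, g.injective.eq_iff]
    refine and_congr_right fun _ => and_congr_right fun _ => and_iff_right_of_imp fun h => ?_
    obtain ⟨i, j, hij, hcij⟩ := hrep
    exact ⟨i, j, hij, (h i j).2 hcij⟩
  have hsum := fun f => sum_comp_eq_sum_inl (M := Fin d → ZMod 2) q
    (fun a => by rw [hclass]; exact hgo a) (fun b => by rw [hclass]; exact hge b) f
  rw [Nat.card_congr (Equiv.subtypeEquivRight hfiber),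
    card_fiber_eq_card_embedding V hq (fun v => ∑ i, v i = t),
    ← Nat.card_congr (embeddingFinsetEquiv V (fun w => ∑ i, w i = t)),
    ← Nat.descFactorial_eq_div (by omega)]
  have hcount := card_embedding_sum (γ := V) (β := Fin (P.filter (fun S => Even S.card)).card)
    (fun f : Fin (P.filter (fun S => Odd S.card)).card ↪ V => ∑ a, (f a : Fin d → ZMod 2) = t)
  rw [Fintype.card_coe, Fintype.card_fin, Fintype.card_fin] at hcount
  rw [← hcount]
  exact Nat.card_congr (Equiv.subtypeEquivRight fun f => by
    rw [hsum (fun x => (f x : Fin d → ZMod 2))]; rfl)
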